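/- Let G be a connected finite simple graph that is claw-free and diamond-free, i.e., G contains no induced subgraph isomorphic to K_{1,3} and no induced subgraph isomorphic to K_4 minus an edge. If G is not isomorphic to the cycle C_4 and not isomorphic to the cycle C_6, then χ_D(G) ≤ Δ(G) + 1. -/

import Mathlib

open SimpleGraph

/-- A proper colouring `c` of `G` is distinguishing if the identity is the only
automorphism of `G` preserving `c`. -/
def SimpleGraph.IsDistinguishingColoring {V α : Type*} (G : SimpleGraph V)
    (c : G.Coloring α) : Prop :=
  ∀ φ : G ≃g G, (∀ v, c (φ v) = c v) → ∀ v, φ v = v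

/-- The distinguishing chromatic number of `G`: the least `k` such that `G` has a
proper vertex colouring with `k` colours preserved only by the identity automorphism. -/
noncomputable def SimpleGraph.distChromNum {V : Type*} (G : SimpleGraph V) : ℕ :=
  sInf {k | ∃ c : G.Coloring (Fin k), G.IsDistinguishingColoring c}

/-- The maximum degree of `G`, stated without decidability assumptions. -/
noncomputable def SimpleGraph.maxDeg {V : Type*} [Fintype V] (G : SimpleGraph V) : ℕ := by
  classical exact G.maxDegree

/-- `G` contains no induced subgraph isomorphic to `H`. -/
def SimpleGraph.IsFreeOf {V W : Type*} (G : SimpleGraph V) (H : SimpleGraph W) : Prop :=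
  ¬ Nonempty (H ↪g G)

/-- The claw `K_{1,3}`. -/
def clawGraph : SimpleGraph (Fin 1 ⊕ Fin 3) := completeBipartiteGraph (Fin 1) (Fin 3)

/-- The diamond `K₄ - e`: the complete graph on four vertices minus the edge
between vertices `0` and `1`. -/
def diamondGraph : SimpleGraph (Fin 4) :=
  SimpleGraph.fromRel fun x y => ¬ (x = 0 ∧ y = 1) ∧ ¬ (x = 1 ∧ y = 0)

namespace DistAux

set_option linter.unusedSimpArgs false

variable {V : Type*}

theorem no_claw {G : SimpleGraph V} (h : G.IsFreeOf clawGraph) {v x y z : V}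
    (hx : G.Adj v x) (hy : G.Adj v y) (hz : G.Adj v z)
    (hxy : ¬ G.Adj x y) (hxz : ¬ G.Adj x z) (hyz : ¬ G.Adj y z)
    (nxy : x ≠ y) (nxz : x ≠ z) (nyz : y ≠ z) : False := by
  apply h
  refine ⟨⟨⟨Sum.elim (fun _ => v) ![x, y, z], ?_⟩, ?_⟩⟩
  · rintro (a | a) (b | b) <;> fin_cases a <;> fin_cases b <;>
      simp [nxy, nxz, nyz, nxy.symm, nxz.symm, nyz.symm, hx.ne, hy.ne, hz.ne,
        hx.ne', hy.ne', hz.ne']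
  · have hyx : ¬ G.Adj y x := fun h => hxy h.symm
    have hzx : ¬ G.Adj z x := fun h => hxz h.symm
    have hzy : ¬ G.Adj z y := fun h => hyz h.symm
    intro a b
    change G.Adj (Sum.elim (fun _ => v) ![x, y, z] a) (Sum.elim (fun _ => v) ![x, y, z] b) ↔ _
    rcases a with a | a <;> rcases b with b | b <;> fin_cases a <;> fin_cases b <;>
      simp [clawGraph, hx, hy, hz, hx.symm, hy.symm, hz.symm, hxy, hxz, hyz, hyx, hzx, hzy]

theorem no_diamond {G : SimpleGraph V} (h : G.IsFreeOf diamondGraph) {v p x y : V}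
    (hvp : G.Adj v p) (hvx : G.Adj v x) (hvy : G.Adj v y) (hpx : G.Adj p x) (hpy : G.Adj p y)
    (hxy : ¬ G.Adj x y) (nxy : x ≠ y) : False := by
  apply h
  refine ⟨⟨⟨![x, y, v, p], ?_⟩, ?_⟩⟩
  · intro a b
    fin_cases a <;> fin_cases b <;>
      simp [nxy, nxy.symm, hvp.ne, hvx.ne, hvy.ne, hpx.ne, hpy.ne,
        hvp.ne', hvx.ne', hvy.ne', hpx.ne', hpy.ne']
  · have hyx : ¬ G.Adj y x := fun h => hxy h.symm
    intro a b
    change G.Adj (![x, y, v, p] a) (![x, y, v, p] b) ↔ _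
    fin_cases a <;> fin_cases b <;>
      simp [diamondGraph, hvp, hvx, hvy, hpx, hpy, hvp.symm, hvx.symm, hvy.symm, hpx.symm,
        hpy.symm, hxy, hyx]

/-- A set closed under adjacency in a connected graph is everything. -/
theorem closed_univ {G : SimpleGraph V} (hconn : G.Connected) (P : V → Prop) {r : V} (hr : P r)
    (h : ∀ x y, P x → G.Adj x y → P y) : ∀ v, P v := by
  intro v
  obtain ⟨w⟩ := hconn.preconnected r v
  induction w with
  | nil => exact hr
  | cons hadj _ ih => exact ih (h _ _ hr hadj)

/-- A colour-preserving automorphism fixing an edge pointwise is trivial. -/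
theorem fix_edge {G : SimpleGraph V} (hconn : G.Connected)
    (hclaw : G.IsFreeOf clawGraph) (hdiamond : G.IsFreeOf diamondGraph)
    {α : Type*} {c : V → α} (hc : ∀ u v, G.Adj u v → c u ≠ c v)
    (φ : G ≃g G) (hφ : ∀ v, c (φ v) = c v) {v p : V} (hvp : G.Adj v p)
    (hv : φ v = v) (hp : φ p = p) : ∀ w, φ w = w := by
  have key : ∀ v p, G.Adj v p → φ v = v → φ p = p → ∀ x, G.Adj v x → φ x = x := by
    intro v p hvp hv hp x hvx
    by_contra hne
    have hnadj : ¬ G.Adj x (φ x) := fun h => hc _ _ h (hφ x).symm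
    have hv' : G.Adj v (φ x) := by
      have := φ.map_adj_iff.2 hvx
      rwa [hv] at this
    have hp' : G.Adj p (φ x) ↔ G.Adj p x := by
      have := φ.map_adj_iff (v := p) (w := x)
      rwa [hp] at this
    by_cases hpx : G.Adj p x
    · exact no_diamond hdiamond hvp hvx hv' hpx (hp'.2 hpx) hnadj (Ne.symm hne)
    · have h1 : p ≠ x := by
        rintro rfl
        exact hne hp
      have h2 : p ≠ φ x := by
        intro h
        apply h1
        apply φ.injective
        rw [hp, ← h]
      exact no_claw hclaw hvp hvx hv' hpx (fun h => hpx (hp'.1 h)) hnadj h1 h2 (Ne.symm hne)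
  have := closed_univ hconn (fun w => φ w = w ∧ ∀ x, G.Adj w x → φ x = x) (r := v)
    ⟨hv, key v p hvp hv hp⟩
    (fun x y hx hxy => ⟨hx.2 y hxy, key y x hxy.symm (hx.2 y hxy) hx.1⟩)
  exact fun w => (this w).1

/-- The main criterion. -/
theorem crit {G : SimpleGraph V} (hconn : G.Connected)
    (hclaw : G.IsFreeOf clawGraph) (hdiamond : G.IsFreeOf diamondGraph)
    {n : ℕ} {c : V → Fin n} (hc : ∀ u v, G.Adj u v → c u ≠ c v)
    {r p : V} (hr : ∀ v, c v = c r → v = r) (hrp : G.Adj r p)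
    (hp : ∀ x, G.Adj r x → c x = c p → x = p) : G.distChromNum ≤ n := by
  apply Nat.sInf_le
  refine ⟨Coloring.mk c (fun {u v} h => hc u v h), fun φ hφ => ?_⟩
  have h1 : φ r = r := hr _ (hφ r)
  have h2 : φ p = p := by
    apply hp _ _ (hφ p)
    have := φ.map_adj_iff.2 hrp
    rwa [h1] at this
  exact fix_edge hconn hclaw hdiamond hc φ hφ hrp h1 h2

theorem greedy [Fintype V] [DecidableEq V] (G : SimpleGraph V) [DecidableRel G.Adj]
    (hconn : G.Connected) (r : V) : ∀ n : ℕ, ∀ s : Finset V, s.card = n → r ∉ s →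
    ∃ c : V → Fin (G.maxDegree + 1), (∀ v ∈ s, c v ≠ 0) ∧
      ∀ u ∈ s, ∀ v ∈ s, G.Adj u v → c u ≠ c v := by
  intro n
  induction n with
  | zero =>
    intro s hs _
    rw [Finset.card_eq_zero] at hs
    subst hs
    exact ⟨fun _ => 0, by simp, by simp⟩
  | succ n ih =>
    intro s hs hr
    have hex : ∃ v ∈ s, ∃ w, w ∉ s ∧ G.Adj v w := by
      by_contra! hcon
      obtain ⟨x, hx⟩ : s.Nonempty := by
        rw [← Finset.card_pos]; omega
      refine hr (closed_univ hconn (fun v => v ∈ s) hx (fun x y hx hxy => ?_) r)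
      by_contra hy
      exact hcon x hx y hy hxy
    obtain ⟨v, hv, w, hw, hvw⟩ := hex
    obtain ⟨c, hc0, hc⟩ := ih (s.erase v) (by rw [Finset.card_erase_of_mem hv]; omega)
      (fun h => hr (Finset.mem_of_mem_erase h))
    have hcard : (insert 0 (((G.neighborFinset v).erase w).image c)).card < G.maxDegree + 1 := by
      have h1 := Finset.card_insert_le (0 : Fin (G.maxDegree + 1))
        (((G.neighborFinset v).erase w).image c)
      have h2 := Finset.card_image_le (s := (G.neighborFinset v).erase w) (f := c)
      have h3 := Finset.card_erase_add_one (s := G.neighborFinset v) (a := w) (by simpa using hvw)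
      rw [G.card_neighborFinset_eq_degree] at h3
      have h4 := G.degree_le_maxDegree v
      omega
    obtain ⟨t, ht⟩ : ∃ t, t ∉ insert 0 (((G.neighborFinset v).erase w).image c) := by
      by_contra! hcon
      rw [Finset.eq_univ_iff_forall.2 hcon] at hcard
      simp at hcard
    simp only [Finset.mem_insert, Finset.mem_image, Finset.mem_erase, mem_neighborFinset,
      not_or, not_exists, not_and] at ht
    refine ⟨Function.update c v t, ?_, ?_⟩
    · intro x hx
      by_cases h : x = v
      · subst h; simpa using ht.1
      · simpa [h] using hc0 x (by simp [h, hx])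
    · have hfree : ∀ x ∈ s, G.Adj v x → c x ≠ t := by
        intro x hx hvx
        refine ht.2 x ⟨?_, hvx⟩
        rintro rfl
        exact hw hx
      intro x hx y hy hxy
      by_cases h : x = v
      · subst h
        simpa [hxy.ne'] using (hfree y hy hxy).symm
      · by_cases h' : y = v
        · subst h'
          simpa [h] using hfree x hx hxy.symm
        · simpa [h, h'] using hc x (by simp [h, hx]) y (by simp [h', hy]) hxy

theorem base_coloring [Fintype V] [DecidableEq V] (G : SimpleGraph V) [DecidableRel G.Adj]
    (hconn : G.Connected) (r : V) :
    ∃ c : V → Fin (G.maxDegree + 1), (∀ u v, G.Adj u v → c u ≠ c v) ∧ ∀ v, c v = 0 ↔ v = r := by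
  obtain ⟨c, hc0, hc⟩ := greedy G hconn r _ (Finset.univ.erase r) rfl (by simp)
  simp only [Finset.mem_erase, Finset.mem_univ, and_true] at hc0 hc
  refine ⟨Function.update c r 0, ?_, ?_⟩
  · intro u v huv
    by_cases h : u = r
    · subst h
      simpa [huv.ne'] using (hc0 v huv.ne').symm
    · by_cases h' : v = r
      · subst h'
        simpa [h] using hc0 u h
      · simpa [h, h'] using hc u h v h' huv
  · intro v
    by_cases h : v = r
    · simp [h]
    · simpa [h] using hc0 v h

/-- The case of maximum degree at least three. -/
theorem big [Fintype V] [DecidableEq V] (G : SimpleGraph V) [DecidableRel G.Adj]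
    (hconn : G.Connected)
    (hclaw : G.IsFreeOf clawGraph) (hdiamond : G.IsFreeOf diamondGraph)
    (hD : 3 ≤ G.maxDegree) : G.distChromNum ≤ G.maxDegree + 1 := by
  have hne : Nonempty V := hconn.nonempty
  obtain ⟨r, hr⟩ := G.exists_maximal_degree_vertex
  obtain ⟨c, hc, hc0⟩ := base_coloring G hconn r
  have hcr : c r = 0 := (hc0 r).2 rfl
  by_cases hU : ∃ p, G.Adj r p ∧ ∀ x, G.Adj r x → c x = c p → x = p
  · obtain ⟨p, hrp, hp⟩ := hU
    exact crit hconn hclaw hdiamond hc (fun v hv => (hc0 v).1 (by rw [hv, hcr])) hrp hp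
  push Not at hU
  -- few colours on the neighbourhood of r
  have hfew : 2 * ((G.neighborFinset r).image c).card ≤ (G.neighborFinset r).card := by
    apply Finset.mul_card_image_le_card
    intro a ha
    obtain ⟨p, hp, rfl⟩ := Finset.mem_image.1 ha
    rw [mem_neighborFinset] at hp
    obtain ⟨x, hx, hxc, hxp⟩ := hU p hp
    have : 1 < ({y ∈ G.neighborFinset r | c y = c p}).card := by
      rw [Finset.one_lt_card]
      exact ⟨x, by simp [hx, hxc], p, by simp [hp], hxp⟩
    exact this
  rw [G.card_neighborFinset_eq_degree] at hfew
  have hT : 1 < (Finset.univ \ insert 0 ((G.neighborFinset r).image c)).card := by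
    rw [Finset.card_univ_sdiff, Fintype.card_fin]
    have := Finset.card_insert_le (0 : Fin (G.maxDegree + 1)) ((G.neighborFinset r).image c)
    omega
  obtain ⟨t, ht, t', ht', htt⟩ := Finset.one_lt_card.1 hT
  simp only [Finset.mem_sdiff, Finset.mem_univ, true_and, Finset.mem_insert, Finset.mem_image,
    mem_neighborFinset, not_or, not_exists, not_and] at ht ht'
  obtain ⟨a, hra⟩ : ∃ a, G.Adj r a := by
    have : 0 < G.degree r := by omega
    exact (G.degree_pos_iff_exists_adj r).1 this
  -- the recoloured graph is properly coloured
  have hprop : ∀ t : Fin (G.maxDegree + 1), t ≠ 0 → (∀ x, G.Adj r x → c x ≠ t) →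
      (∀ u v, G.Adj u v → Function.update (Function.update c r t) a 0 u ≠
        Function.update (Function.update c r t) a 0 v) ∧
      ∀ v, Function.update (Function.update c r t) a 0 v =
        Function.update (Function.update c r t) a 0 a → v = a := by
    intro t h0 hn
    have hz : ∀ v, v ≠ a → Function.update (Function.update c r t) a 0 v ≠ 0 := by
      intro v hva
      by_cases h : v = r
      · subst h; simpa [hva] using h0
      · simpa [hva, h] using fun h' => h ((hc0 v).1 h')
    have hrr : ∀ v, v ≠ a → G.Adj r v → Function.update (Function.update c r t) a 0 v ≠ t := by
      intro v hva hv
      simpa [hva, hv.ne'] using hn v hv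
    have hrt : Function.update (Function.update c r t) a 0 r = t := by simp [hra.ne]
    constructor
    · intro u v huv
      by_cases h1 : u = a
      · subst h1
        simpa using (hz v huv.ne').symm
      by_cases h2 : v = a
      · subst h2
        simpa using hz u h1
      by_cases h3 : u = r
      · subst h3
        rw [hrt]
        exact (hrr v h2 huv).symm
      by_cases h4 : v = r
      · subst h4
        rw [hrt]
        exact hrr u h1 huv.symm
      simpa [h1, h2, h3, h4] using hc u v huv
    · intro v hv
      by_contra h
      apply hz v h
      simpa using hv
  by_cases hx : ∃ x, G.Adj a x ∧ x ≠ r ∧ c x = t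
  · obtain ⟨x, hax, hxr, hxt⟩ := hx
    obtain ⟨hp1, hp2⟩ := hprop t' ht'.1 ht'.2
    refine crit hconn hclaw hdiamond hp1 hp2 hax ?_
    intro y hay hy
    by_cases hyr : y = r
    · subst hyr
      simp [hra.ne, hax.ne', hxr, hxt] at hy
      exact absurd hy.symm htt
    · simp only [Function.update, hay.ne', hax.ne', hyr, hxr, dite_false] at hy
      have hy' : c y = t := by rw [hy, hxt]
      by_contra hyx
      exact no_claw hclaw hra.symm hay hax (fun h => ht.2 y h hy') (fun h => ht.2 x h hxt)
        (fun h => hc _ _ h (by rw [hy', hxt])) (Ne.symm hyr) (Ne.symm hxr) hyx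
  · push Not at hx
    obtain ⟨hp1, hp2⟩ := hprop t ht.1 ht.2
    refine crit hconn hclaw hdiamond hp1 hp2 hra.symm ?_
    intro y hay hy
    by_contra hyr
    apply hx y hay hyr
    simpa [Function.update, hay.ne', hyr, hra.ne] using hy

theorem iso_cycle {G : SimpleGraph V} (hconn : G.Connected) {n : ℕ} (f : Fin (n + 2) → V)
    (hf : Function.Injective f)
    (h : ∀ i x, G.Adj (f i) x ↔ x = f (i - 1) ∨ x = f (i + 1)) :
    Nonempty (G ≃g cycleGraph (n + 2)) := by
  have hs : Function.Surjective f := by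
    refine closed_univ hconn (fun v => ∃ i, f i = v) (r := f 0) ⟨0, rfl⟩ ?_
    rintro x y ⟨i, rfl⟩ hxy
    rcases (h i y).1 hxy with h | h
    · exact ⟨_, h.symm⟩
    · exact ⟨_, h.symm⟩
  refine ⟨RelIso.symm ⟨Equiv.ofBijective f ⟨hf, hs⟩, ?_⟩⟩
  intro i j
  change G.Adj (f i) (f j) ↔ _
  rw [h, hf.eq_iff, hf.eq_iff, cycleGraph_adj]
  constructor
  · rintro (h | h) <;> subst h <;> simp
  · rintro (h | h)
    · left; rw [← h]; abel
    · right; rw [← h]; abel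

/-- The case of cycles. -/
theorem cyc [Fintype V] [DecidableEq V] (G : SimpleGraph V) [DecidableRel G.Adj]
    (hconn : G.Connected)
    (hclaw : G.IsFreeOf clawGraph) (hdiamond : G.IsFreeOf diamondGraph)
    (hC4 : ¬ Nonempty (G ≃g cycleGraph 4)) (hC6 : ¬ Nonempty (G ≃g cycleGraph 6))
    (hD : G.maxDegree = 2) (hreg : ∀ v, G.degree v = 2) :
    G.distChromNum ≤ G.maxDegree + 1 := by
  have hother : ∀ v x, G.Adj v x → ∃ y, y ≠ x ∧ ∀ z, G.Adj v z ↔ z = x ∨ z = y := by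
    intro v x hvx
    have h2 := hreg v
    rw [← G.card_neighborFinset_eq_degree, Finset.card_eq_two] at h2
    obtain ⟨p, q, hpq, hN⟩ := h2
    have hz : ∀ z, G.Adj v z ↔ z = p ∨ z = q := by
      intro z
      rw [← mem_neighborFinset, hN]; simp
    rcases (hz x).1 hvx with rfl | rfl
    · exact ⟨q, hpq.symm, hz⟩
    · exact ⟨p, hpq, fun z => by rw [hz, or_comm]⟩
  have hne : Nonempty V := hconn.nonempty
  obtain ⟨r⟩ := hne
  obtain ⟨a, hra⟩ : ∃ a, G.Adj r a := by
    have : 0 < G.degree r := by rw [hreg]; omega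
    exact (G.degree_pos_iff_exists_adj r).1 this
  obtain ⟨c, hc, hc0⟩ := base_coloring G hconn r
  have hcr : c r = 0 := (hc0 r).2 rfl
  obtain ⟨b, hba, hr⟩ := hother r a hra
  have hrb : G.Adj r b := (hr b).2 (Or.inr rfl)
  by_cases hab : c b = c a
  swap
  · refine crit hconn hclaw hdiamond hc (fun v hv => (hc0 v).1 (by rw [hv, hcr])) hra ?_
    intro x hx hxc
    rcases (hr x).1 hx with rfl | rfl
    · rfl
    · exact absurd hxc hab
  have hca : c a ≠ 0 := fun h => hra.ne' ((hc0 a).1 h)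
  have nab : ¬ G.Adj a b := fun h => hc _ _ h hab.symm
  -- the two colours other than 0
  have two : ∀ x y z : Fin (G.maxDegree + 1), x ≠ 0 → y ≠ 0 → z ≠ 0 → y ≠ x → z ≠ x → y = z := by
    rw [hD]; decide
  obtain ⟨a2, ha2r, hNa⟩ := hother a r hra.symm
  obtain ⟨b2, hb2r, hNb⟩ := hother b r hrb.symm
  have haa2 : G.Adj a a2 := (hNa _).2 (Or.inr rfl)
  have hbb2 : G.Adj b b2 := (hNb _).2 (Or.inr rfl)
  have hca2 : c a2 ≠ 0 := fun h => ha2r ((hc0 _).1 h)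
  have hcb2 : c b2 ≠ 0 := fun h => hb2r ((hc0 _).1 h)
  have hc22 : c a2 = c b2 :=
    two (c a) _ _ hca hca2 hcb2 (hc _ _ haa2).symm (hab ▸ (hc _ _ hbb2).symm)
  have ha2b : a2 ≠ b := fun h => nab (h ▸ haa2)
  have hb2a : b2 ≠ a := fun h => nab (h ▸ hbb2).symm
  obtain ⟨a3, ha3a, hNa2⟩ := hother a2 a haa2.symm
  obtain ⟨b3, hb3b, hNb2⟩ := hother b2 b hbb2.symm
  by_cases h4 : a2 = b2
  · exfalso
    apply hC4
    subst h4
    have hb3 : a3 = b := by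
      rcases (hNa2 b).1 hbb2.symm with h | h
      · exact absurd h hba
      · exact h.symm
    subst hb3
    refine iso_cycle hconn (n := 2) ![r, a, a2, a3] ?_ ?_
    · intro i j
      fin_cases i <;> fin_cases j <;>
        simp [hba, hba.symm, hra.ne, hra.ne', hrb.ne, hrb.ne', ha2r, ha2r.symm,
          haa2.ne, haa2.ne', ha2b, ha2b.symm]
    · intro i x
      fin_cases i
      · simpa [or_comm] using hr x
      · simpa using hNa x
      · simpa using hNa2 x
      · simpa [or_comm] using hNb x
  have ha23 : G.Adj a2 a3 := (hNa2 _).2 (Or.inr rfl)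
  have hb23 : G.Adj b2 b3 := (hNb2 _).2 (Or.inr rfl)
  have ha3r : a3 ≠ r := by
    intro h
    rw [h] at ha23
    rcases (hr a2).1 ha23.symm with h | h
    · exact haa2.ne' h
    · exact ha2b h
  have hb3r : b3 ≠ r := by
    intro h
    rw [h] at hb23
    rcases (hr b2).1 hb23.symm with h | h
    · exact hb2a h
    · exact hbb2.ne' h
  have ha3b : a3 ≠ b := by
    intro h
    rw [h] at ha23
    rcases (hNb a2).1 ha23.symm with h | h
    · exact ha2r h
    · exact h4 h
  have hb3a : b3 ≠ a := by
    intro h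
    rw [h] at hb23
    rcases (hNa b2).1 hb23.symm with h | h
    · exact hb2r h
    · exact h4 h.symm
  have hca3 : c a3 ≠ 0 := fun h => ha3r ((hc0 _).1 h)
  have hc13 : c a3 = c a := two (c a2) _ _ hca2 hca3 hca (hc _ _ ha23).symm (hc _ _ haa2)
  by_cases h6 : a3 = b3
  · exfalso
    apply hC6
    subst h6
    obtain ⟨q, hq, hN3⟩ := hother a3 a2 ha23.symm
    have hqb : q = b2 := by
      rcases (hN3 b2).1 hb23.symm with h | h
      · exact absurd h.symm h4
      · exact h.symm
    subst hqb
    refine iso_cycle hconn (n := 4) ![r, a, a2, a3, q, b] ?_ ?_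
    · intro i j
      fin_cases i <;> fin_cases j <;>
        simp [hba, hba.symm, hra.ne, hra.ne', hrb.ne, hrb.ne', ha2r, ha2r.symm,
          haa2.ne, haa2.ne', ha2b, ha2b.symm, hb2r, hb2r.symm, hb2a, hb2a.symm, hbb2.ne,
          hbb2.ne', ha23.ne, ha23.ne', hb23.ne, hb23.ne', ha3r, ha3r.symm, ha3b, ha3b.symm,
          ha3a, ha3a.symm, h4, hq]
    · intro i x
      fin_cases i
      · simpa [or_comm] using hr x
      · simpa using hNa x
      · simpa using hNa2 x
      · simpa using hN3 x
      · simpa [or_comm] using hNb2 x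
      · simpa [or_comm] using hNb x
  -- recolour a3 by 0
  have hra3 : ¬ G.Adj r a3 := fun h => by
    rcases (hr a3).1 h with h | h
    · exact ha3a h
    · exact ha3b h
  have hc' : ∀ u v, G.Adj u v → Function.update c a3 0 u ≠ Function.update c a3 0 v := by
    intro u v huv
    by_cases h1 : u = a3
    · subst h1
      have : v ≠ r := fun h => hra3 (h ▸ huv.symm)
      simpa [huv.ne'] using fun h : 0 = c v => this ((hc0 v).1 h.symm)
    by_cases h2 : v = a3
    · subst h2
      have : u ≠ r := fun h => hra3 (h ▸ huv)
      simpa [h1] using fun h : c u = 0 => this ((hc0 u).1 h)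
    simpa [h1, h2] using hc u v huv
  apply Nat.sInf_le
  refine ⟨Coloring.mk (Function.update c a3 0) (fun {u v} h => hc' u v h), fun φ hφ => ?_⟩
  replace hφ : ∀ v, Function.update c a3 0 (φ v) = Function.update c a3 0 v := hφ
  have hzero : ∀ v, Function.update c a3 0 v = 0 → v = a3 ∨ v = r := by
    intro v hv
    by_cases h : v = a3
    · exact Or.inl h
    · right
      rw [Function.update_of_ne h] at hv
      exact (hc0 v).1 hv
  have hφr : φ r = r := by
    rcases hzero (φ r) (by rw [hφ, Function.update_of_ne ha3r.symm, hcr]) with h | h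
    · exfalso
      have h1 : G.Adj a3 (φ a) := by
        have := φ.map_adj_iff.2 hra
        rwa [h] at this
      have h2 := hφ a
      rw [Function.update_of_ne h1.ne', Function.update_of_ne ha3a.symm] at h2
      exact hc _ _ h1 (by rw [h2, hc13])
    · exact h
  have hφa : G.Adj r (φ a) := by
    have := φ.map_adj_iff.2 hra
    rwa [hφr] at this
  rcases (hr _).1 hφa with h | h
  · exact fix_edge hconn hclaw hdiamond hc' φ hφ hra hφr h
  · exfalso
    have h2 : φ a2 = b2 := by
      have h1 := φ.map_adj_iff.2 haa2
      rw [h] at h1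
      rcases (hNb _).1 h1 with h' | h'
      · exact absurd (φ.injective (h'.trans hφr.symm)) ha2r
      · exact h'
    have h3 : φ a3 = b3 := by
      have h1 := φ.map_adj_iff.2 ha23
      rw [h2] at h1
      rcases (hNb2 _).1 h1 with h' | h'
      · exact absurd (φ.injective (h'.trans h.symm)) ha3a
      · exact h'
    rcases hzero (φ a3) (by rw [hφ]; simp) with h' | h'
    · exact h6 (h'.symm.trans h3)
    · exact hb3r (h3.symm.trans h')

theorem main [Fintype V] [DecidableEq V] (G : SimpleGraph V) [DecidableRel G.Adj]
    (hconn : G.Connected)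
    (hclaw : G.IsFreeOf clawGraph) (hdiamond : G.IsFreeOf diamondGraph)
    (hC4 : ¬ Nonempty (G ≃g cycleGraph 4)) (hC6 : ¬ Nonempty (G ≃g cycleGraph 6)) :
    G.distChromNum ≤ G.maxDegree + 1 := by
  by_cases hD : 3 ≤ G.maxDegree
  · exact big G hconn hclaw hdiamond hD
  by_cases h1 : ∃ r, G.degree r = 1
  · obtain ⟨r, hr⟩ := h1
    obtain ⟨p, hp, hu⟩ := (G.degree_eq_one_iff_existsUnique_adj).1 hr
    obtain ⟨c, hc, hc0⟩ := base_coloring G hconn r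
    exact crit hconn hclaw hdiamond hc
      (fun v hv => (hc0 v).1 (by rw [hv, (hc0 r).2 rfl])) hp (fun x hx _ => hu x hx)
  by_cases h0 : ∃ r, G.degree r = 0
  · obtain ⟨r, hr⟩ := h0
    have hall : ∀ v, v = r := by
      refine closed_univ hconn (fun v => v = r) rfl ?_
      rintro x y rfl hxy
      have := (G.degree_pos_iff_exists_adj x).2 ⟨y, hxy⟩
      omega
    obtain ⟨c, hc, hc0⟩ := base_coloring G hconn r
    apply Nat.sInf_le
    exact ⟨Coloring.mk c (fun {u v} h => hc u v h), fun φ _ v => by rw [hall v, hall (φ r)]⟩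
  push Not at h1 h0
  have hreg : ∀ v, G.degree v = 2 := by
    intro v
    have := G.degree_le_maxDegree v
    have := h1 v
    have := h0 v
    omega
  have hD2 : G.maxDegree = 2 := by
    obtain ⟨v⟩ := hconn.nonempty
    have := G.degree_le_maxDegree v
    have := hreg v
    omega
  exact cyc G hconn hclaw hdiamond hC4 hC6 hD2 hreg

end DistAux

theorem statement_16 {V : Type*} [Fintype V] (G : SimpleGraph V)
    (hconn : G.Connected)
    (hclaw : G.IsFreeOf clawGraph) (hdiamond : G.IsFreeOf diamondGraph)
    (hC4 : ¬ Nonempty (G ≃g cycleGraph 4)) (hC6 : ¬ Nonempty (G ≃g cycleGraph 6)) :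
    G.distChromNum ≤ G.maxDeg + 1 := by
  classical
  unfold SimpleGraph.maxDeg
  exact DistAux.main G hconn hclaw hdiamond hC4 hC6
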